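/- Let K be a field of characteristic zero, let B be a degree reducing linear operator on K[x] with divided power sequence (b_n)_{n≥0}, and let Q be a linear operator on K[x]. Then Q commutes with B (Q ∘ B = B ∘ Q) if and only if there exists a sequence of scalars (c_k)_{k≥0} in K such that for every polynomial p, Q p = Σ_{k=0}^{deg p} c_k · (B^k p); in that case the coefficients are given by c_k = (Q b_k)(0), the constant term of Q b_k. -/

import Mathlib

/-- A linear operator `B` on `K[x]` is *degree reducing* if it kills constants and
lowers the degree of every nonconstant polynomial by exactly one. -/
def DegreeReducing {K : Type*} [Field K] (B : Module.End K (Polynomial K)) : Prop :=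
  (∀ c : K, B (Polynomial.C c) = 0) ∧
    ∀ p : Polynomial K, 0 < p.degree → (B p).degree + 1 = p.degree

/-- `b` is the divided power sequence of `B`: `B b₀ = 0`, `B bₙ = bₙ₋₁`, `bₙ(0) = δₙ₀`. -/
def IsDividedPowerSeq {K : Type*} [Field K] (B : Module.End K (Polynomial K))
    (b : ℕ → Polynomial K) : Prop :=
  B (b 0) = 0 ∧ (∀ n : ℕ, B (b (n + 1)) = b n) ∧
    ∀ n : ℕ, (b n).eval 0 = if n = 0 then 1 else 0

open Polynomial in
theorem DegreeReducing.eq_zero_of_apply_eq_zero {K : Type*} [Field K] {B : Module.End K K[X]}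
    (hB : DegreeReducing B) {p : K[X]} (hp : B p = 0) (h0 : p.eval 0 = 0) : p = 0 := by
  have hdeg : p.degree ≤ 0 := by
    by_contra! h
    have h1 := hB.2 p h
    rw [hp, degree_zero, WithBot.bot_add] at h1
    rw [← h1] at h
    exact absurd h not_lt_bot
  rw [eq_C_of_degree_le_zero hdeg, eval_C] at h0
  rw [eq_C_of_degree_le_zero hdeg, h0, C_0]

open Polynomial in
theorem DegreeReducing.natDegree_apply_le {K : Type*} [Field K] {B : Module.End K K[X]}
    (hB : DegreeReducing B) (p : K[X]) : (B p).natDegree ≤ p.natDegree - 1 := by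
  rcases le_or_gt p.degree 0 with h | h
  · rw [eq_C_of_degree_le_zero h, hB.1]
    simp
  · have h1 := hB.2 p h
    have hp : p ≠ 0 := by
      rintro rfl
      simp at h
    have hBp : B p ≠ 0 := by
      intro h2
      rw [h2, degree_zero, WithBot.bot_add] at h1
      exact hp (degree_eq_bot.mp h1.symm)
    rw [degree_eq_natDegree hp, degree_eq_natDegree hBp] at h1
    have h2 : (B p).natDegree + 1 = p.natDegree := by exact_mod_cast h1
    omega

open Polynomial in
theorem DegreeReducing.pow_apply_eq_zero {K : Type*} [Field K] {B : Module.End K K[X]}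
    (hB : DegreeReducing B) {n : ℕ} {p : K[X]} (h : p.natDegree < n) : (B ^ n) p = 0 := by
  induction n generalizing p with
  | zero => omega
  | succ n ih =>
    rw [pow_succ, Module.End.mul_apply]
    rcases Nat.eq_zero_or_pos p.natDegree with h0 | h0
    · rw [eq_C_of_natDegree_eq_zero h0, hB.1, map_zero]
    · have := hB.natDegree_apply_le p
      exact ih (by omega)

open Polynomial in
theorem DegreeReducing.sum_range_eq {K : Type*} [Field K] {B : Module.End K K[X]}
    (hB : DegreeReducing B) (c : ℕ → K) {p : K[X]} {n : ℕ} (h : p.natDegree < n) :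
    ∑ k ∈ Finset.range (p.natDegree + 1), c k • (B ^ k) p =
      ∑ k ∈ Finset.range n, c k • (B ^ k) p := by
  refine Finset.sum_subset (Finset.range_subset_range.mpr h) fun k _ hk => ?_
  rw [hB.pow_apply_eq_zero (by simpa using hk), smul_zero]

open Polynomial in
theorem IsDividedPowerSeq.eval_zero_pow_apply {K : Type*} [Field K] {B : Module.End K K[X]}
    {b : ℕ → K[X]} (hb : IsDividedPowerSeq B b) (j k : ℕ) :
    ((B ^ j) (b k)).eval 0 = if j = k then 1 else 0 := by
  induction j generalizing k with
  | zero => simp [hb.2.2, eq_comm]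
  | succ j ih =>
    rw [pow_succ, Module.End.mul_apply]
    cases k with
    | zero => simp [hb.1]
    | succ k => simp [hb.2.1, ih]

open Polynomial in
/-- Taylor expansion with respect to a degree reducing operator. -/
theorem IsDividedPowerSeq.eq_sum {K : Type*} [Field K] {B : Module.End K K[X]}
    (hB : DegreeReducing B) {b : ℕ → K[X]} (hb : IsDividedPowerSeq B b) {n : ℕ} {p : K[X]}
    (hp : (B ^ n) p = 0) :
    p = ∑ k ∈ Finset.range n, ((B ^ k) p).eval 0 • b k := by
  induction n generalizing p with
  | zero => simpa using hp
  | succ n ih =>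
    rw [pow_succ, Module.End.mul_apply] at hp
    refine sub_eq_zero.mp (hB.eq_zero_of_apply_eq_zero ?_ ?_)
    · rw [map_sub, sub_eq_zero, map_sum, Finset.sum_range_succ']
      simp only [map_smul, hb.1, hb.2.1, smul_zero, add_zero]
      conv_lhs => rw [ih hp]
      simp only [pow_succ, Module.End.mul_apply]
    · simp [eval_finsetSum, hb.2.2]

open Polynomial in
theorem IsDividedPowerSeq.apply_eq_sum_of_commute {K : Type*} [Field K] {B Q : Module.End K K[X]}
    (hB : DegreeReducing B) {b : ℕ → K[X]} (hb : IsDividedPowerSeq B b) (hQ : Commute Q B)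
    {n : ℕ} {p : K[X]} (hp : (B ^ n) p = 0) :
    Q p = ∑ k ∈ Finset.range n, (Q (b k)).eval 0 • (B ^ k) p := by
  induction n generalizing p with
  | zero =>
    have h : p = 0 := by simpa using hp
    simp [h]
  | succ n ih =>
    refine sub_eq_zero.mp (hB.eq_zero_of_apply_eq_zero ?_ ?_)
    · have hp' : (B ^ n) (B p) = 0 := by
        rwa [pow_succ, Module.End.mul_apply] at hp
      have hc : B (Q p) = Q (B p) := (LinearMap.congr_fun hQ.eq p).symm
      rw [map_sub, sub_eq_zero, hc, ih hp', map_sum, Finset.sum_range_succ]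
      simp only [map_smul, ← Module.End.mul_apply, ← pow_succ, ← pow_succ']
      rw [hp, smul_zero, add_zero]
    · conv_lhs => enter [2, 1]; rw [hb.eq_sum hB hp]
      simp [eval_finsetSum, mul_comm]

/-- **B-expansion formula.**  Let `B` be degree reducing with divided power sequence
`(bₙ)`.  A linear operator `Q` commutes with `B` iff there are scalars `(cₖ)` with
`Q p = ∑_{k=0}^{deg p} cₖ • (Bᵏ p)` for all `p`; in that case `cₖ = (Q bₖ)(0)`. -/
theorem b_expansion_formula {K : Type*} [Field K] [CharZero K]
    (B : Module.End K (Polynomial K)) (hB : DegreeReducing B)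
    (b : ℕ → Polynomial K) (hb : IsDividedPowerSeq B b)
    (Q : Module.End K (Polynomial K)) :
    (Q * B = B * Q ↔ ∃ c : ℕ → K, ∀ p : Polynomial K,
        Q p = ∑ k ∈ Finset.range (p.natDegree + 1), c k • (B ^ k) p) ∧
      ∀ c : ℕ → K,
        (∀ p : Polynomial K,
            Q p = ∑ k ∈ Finset.range (p.natDegree + 1), c k • (B ^ k) p) →
          ∀ k : ℕ, c k = (Q (b k)).eval 0 := by
  refine ⟨⟨fun h => ⟨fun k => (Q (b k)).eval 0, fun p => ?_⟩, ?_⟩, fun c hc k => ?_⟩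
  · exact hb.apply_eq_sum_of_commute hB h (hB.pow_apply_eq_zero (Nat.lt_succ_self _))
  · rintro ⟨c, hc⟩
    refine LinearMap.ext fun p => ?_
    have hlt : (B p).natDegree < p.natDegree + 1 := by
      have := hB.natDegree_apply_le p
      omega
    rw [Module.End.mul_apply, Module.End.mul_apply, hc p, hc (B p), hB.sum_range_eq c hlt, map_sum]
    simp only [map_smul, ← Module.End.mul_apply, ← pow_succ, ← pow_succ']
  · rw [hc, hB.sum_range_eq c (n := (b k).natDegree + k + 1) (by omega)]
    simp [Polynomial.eval_finsetSum, hb.eval_zero_pow_apply]
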